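/- arXiv:2501.16333 — 2 statements merged into one kernel-verified Lean document; each statement's English description precedes it below -/
import Mathlib

section
/- Under the stated Gaussian sensor model, for every y ∈ ℝ the random variables exp(−c²X²/(2σ²) + cXy/σ²) and X·exp(−c²X²/(2σ²) + cXy/σ²) are integrable, the denominator E[exp(−c²X²/(2σ²) + cXy/σ²)] is strictly positive, and the conditional expectation of X given Y satisfies E[X | Y] = g(Y) almost surely, where g(y) := E[ X exp(−c²X²/(2σ²) + cXy/σ²) ] / E[ exp(−c²X²/(2σ²) + cXy/σ²) ]. -/
open MeasureTheory ProbabilityTheory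
open scoped NNReal ENNReal

/-- Abstract Bayes formula for a joint law with a density with respect to a product measure. -/
lemma abstract_bayes {Ω : Type*} {mΩ : MeasurableSpace Ω} (P : Measure Ω) [IsProbabilityMeasure P]
    (X Y : Ω → ℝ) (hX : Measurable X) (hY : Measurable Y) (hXi : Integrable X P)
    (ν γ : Measure ℝ) [IsProbabilityMeasure ν] [IsProbabilityMeasure γ]
    (k : ℝ × ℝ → ℝ) (hk : Measurable k) (hk0 : ∀ p, 0 ≤ k p)
    (hlaw : P.map (fun ω => (X ω, Y ω)) = (ν.prod γ).withDensity (fun p => ENNReal.ofReal (k p)))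
    (hki : ∀ y, Integrable (fun x => k (x, y)) ν)
    (hD : ∀ y, 0 < ∫ x, k (x, y) ∂ν) :
    P[X | MeasurableSpace.comap Y inferInstance] =ᵐ[P] fun ω =>
      (∫ x, x * k (x, Y ω) ∂ν) / (∫ x, k (x, Y ω) ∂ν) := by
  set N : ℝ → ℝ := fun y => ∫ x, x * k (x, y) ∂ν with hN
  set D : ℝ → ℝ := fun y => ∫ x, k (x, y) ∂ν with hDdef
  have hXY : Measurable (fun ω => (X ω, Y ω)) := hX.prodMk hY
  have hkE : Measurable (fun p => ENNReal.ofReal (k p)) := hk.ennreal_ofReal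
  have hNm : StronglyMeasurable N :=
    StronglyMeasurable.integral_prod_left' (f := fun p : ℝ × ℝ => p.1 * k p)
      (measurable_fst.mul hk).stronglyMeasurable
  have hDm : StronglyMeasurable D := StronglyMeasurable.integral_prod_left' hk.stronglyMeasurable
  have hgm : Measurable (fun y => N y / D y) := hNm.measurable.div hDm.measurable
  have key_int : ∀ F : ℝ × ℝ → ℝ, Measurable F →
      (Integrable (fun ω => F (X ω, Y ω)) P ↔ Integrable (fun p => k p * F p) (ν.prod γ)) := by
    intro F hF
    have h1 := integrable_map_measure (μ := P) (f := fun ω => (X ω, Y ω)) (g := F)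
      hF.aestronglyMeasurable hXY.aemeasurable
    rw [hlaw, integrable_withDensity_iff_integrable_smul' hkE
      (by filter_upwards with p using ENNReal.ofReal_lt_top)] at h1
    simp only [ENNReal.toReal_ofReal (hk0 _), smul_eq_mul] at h1
    exact h1.symm
  have key_eq : ∀ F : ℝ × ℝ → ℝ, Measurable F →
      ∫ ω, F (X ω, Y ω) ∂P = ∫ p, k p * F p ∂(ν.prod γ) := by
    intro F hF
    have h1 := integral_map (μ := P) (φ := fun ω => (X ω, Y ω)) hXY.aemeasurable
      hF.aestronglyMeasurable
    rw [← h1, hlaw, integral_withDensity_eq_integral_toReal_smul hkE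
      (by filter_upwards with p using ENNReal.ofReal_lt_top)]
    simp only [ENNReal.toReal_ofReal (hk0 _), smul_eq_mul]
  have hNi : Integrable (fun p : ℝ × ℝ => k p * p.1) (ν.prod γ) :=
    (key_int (fun p => p.1) measurable_fst).1 hXi
  have hNint : Integrable N γ := by
    have := hNi.integral_prod_right
    simpa only [hN, mul_comm] using this
  have hgY : Integrable (fun ω => N (Y ω) / D (Y ω)) P := by
    refine (key_int (fun p => N p.2 / D p.2) (hgm.comp measurable_snd)).2 ?_
    have hmm : Measurable (fun p : ℝ × ℝ => k p * (N p.2 / D p.2)) :=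
      hk.mul (hgm.comp measurable_snd)
    rw [integrable_prod_iff' hmm.aestronglyMeasurable]
    refine ⟨.of_forall fun y => (hki y).mul_const (N y / D y), hNint.norm.congr (.of_forall fun y => ?_)⟩
    simp only [norm_mul, Real.norm_of_nonneg (hk0 _)]
    rw [integral_mul_const, norm_div, Real.norm_of_nonneg (hD y).le]
    exact (mul_div_cancel₀ _ (hD y).ne').symm
  refine (ae_eq_condExp_of_forall_setIntegral_eq hY.comap_le hXi
    (fun s _ _ => hgY.integrableOn) ?_ ?_).symm
  · rintro s ⟨B, hB, rfl⟩ -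
    have hpre : MeasurableSet (Y ⁻¹' B) := hY hB
    have hYB : ∀ f : Ω → ℝ, ∫ ω in Y ⁻¹' B, f ω ∂P =
        ∫ ω, B.indicator (fun _ => (1 : ℝ)) (Y ω) * f ω ∂P := by
      intro f
      rw [← integral_indicator hpre]
      congr 1
      ext ω
      by_cases h : Y ω ∈ B <;> simp [Set.indicator, h]
    have hBm : Measurable (B.indicator (fun _ => (1 : ℝ))) := measurable_const.indicator hB
    have hBi : ∀ f : Ω → ℝ, Integrable f P →
        Integrable (fun ω => B.indicator (fun _ => (1 : ℝ)) (Y ω) * f ω) P := by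
      intro f hf
      refine hf.bdd_mul (c := 1) (hBm.comp hY).aestronglyMeasurable (.of_forall fun ω => ?_)
      by_cases h : Y ω ∈ B <;> simp [Set.indicator, h]
    rw [hYB, hYB]
    have m1 : Measurable (fun p : ℝ × ℝ =>
        B.indicator (fun _ => (1 : ℝ)) p.2 * (N p.2 / D p.2)) :=
      (hBm.comp measurable_snd).mul (hgm.comp measurable_snd)
    have m2 : Measurable (fun p : ℝ × ℝ => B.indicator (fun _ => (1 : ℝ)) p.2 * p.1) :=
      (hBm.comp measurable_snd).mul measurable_fst
    rw [key_eq _ m1, key_eq _ m2, integral_prod_symm _ ((key_int _ m1).1 (hBi _ hgY)),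
      integral_prod_symm _ ((key_int _ m2).1 (hBi _ hXi))]
    congr 1
    ext y
    simp only
    rw [integral_mul_const]
    have : ∀ x, k (x, y) * (B.indicator (fun _ => (1 : ℝ)) y * x) =
      B.indicator (fun _ => (1 : ℝ)) y * (x * k (x, y)) := fun x => by ring
    simp only [this]
    rw [integral_const_mul]
    change D y * (_ * (N y / D y)) = _ * N y
    have := (hD y).ne'
    change D y ≠ 0 at this
    field_simp
  · exact (hgm.comp (comap_measurable Y)).aestronglyMeasurable

lemma gaussian_shift_density (m : ℝ) (v : ℝ≥0) (hv : v ≠ 0) :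
    gaussianReal m v = (gaussianReal 0 v).withDensity
      (fun y => ENNReal.ofReal (Real.exp (-(m ^ 2) / (2 * v) + m * y / v))) := by
  rw [gaussianReal_of_var_ne_zero _ hv, gaussianReal_of_var_ne_zero _ hv,
    ← withDensity_mul _ (measurable_gaussianPDF _ _) (by fun_prop)]
  congr 1
  ext y
  have hv' : (v : ℝ) ≠ 0 := by exact_mod_cast hv
  simp only [Pi.mul_apply, gaussianPDF]
  rw [← ENNReal.ofReal_mul (gaussianPDFReal_nonneg _ _ _)]
  simp only [gaussianPDFReal]
  rw [mul_assoc (√(2 * Real.pi * v))⁻¹, ← Real.exp_add]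
  congr 3
  field_simp
  ring

lemma gaussian_joint_law {Ω : Type*} {mΩ : MeasurableSpace Ω} (P : Measure Ω)
    [IsProbabilityMeasure P]
    (X Z : Ω → ℝ) (hX : Measurable X) (hZ : Measurable Z) (hindep : IndepFun X Z P)
    (hZlaw : P.map Z = gaussianReal 0 1) (c σ : ℝ) (hσ : 0 < σ) :
    P.map (fun ω => (X ω, c * X ω + σ * Z ω)) =
      ((P.map X).prod (gaussianReal 0 (NNReal.mk (σ ^ 2) (sq_nonneg σ)))).withDensity (fun p =>
        ENNReal.ofReal (Real.exp (-(c ^ 2 * p.1 ^ 2) / (2 * σ ^ 2) + c * p.1 * p.2 / σ ^ 2))) := by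
  have : IsProbabilityMeasure (P.map X) := Measure.isProbabilityMeasure_map hX.aemeasurable
  have hv : NNReal.mk (σ ^ 2) (sq_nonneg σ) ≠ 0 := by
    intro h
    have := congrArg NNReal.toReal h
    change σ ^ 2 = 0 at this
    exact (pow_pos hσ 2).ne' this
  have hT : Measurable (fun p : ℝ × ℝ => (p.1, c * p.1 + σ * p.2)) := by fun_prop
  have hmap : P.map (fun ω => (X ω, c * X ω + σ * Z ω)) =
      ((P.map X).prod (gaussianReal 0 1)).map (fun p : ℝ × ℝ => (p.1, c * p.1 + σ * p.2)) := by
    rw [← hZlaw, ← (indepFun_iff_map_prod_eq_prod_map_map hX.aemeasurable hZ.aemeasurable).1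
      hindep, Measure.map_map hT (hX.prodMk hZ)]
    rfl
  have haff : ∀ x : ℝ, (gaussianReal 0 1).map (fun z => c * x + σ * z) =
      gaussianReal (c * x) (NNReal.mk (σ ^ 2) (sq_nonneg σ)) := by
    intro x
    have h1 := gaussianReal_map_const_mul (μ := 0) (v := 1) σ
    have h2 : (fun z => c * x + σ * z) = (fun w => c * x + w) ∘ (fun z => σ * z) := rfl
    rw [h2, ← Measure.map_map (by fun_prop) (by fun_prop), h1, gaussianReal_map_const_add]
    simp
  rw [hmap]
  refine Measure.ext_of_lintegral _ fun f hf => ?_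
  rw [lintegral_map hf hT, lintegral_prod _ (by fun_prop),
    lintegral_withDensity_eq_lintegral_mul _ (by fun_prop) hf,
    lintegral_prod _ (by fun_prop)]
  refine lintegral_congr fun x => ?_
  have hfx : Measurable (fun y => f (x, y)) := by fun_prop
  have h3 := lintegral_map (μ := gaussianReal 0 1) (g := fun z => c * x + σ * z) hfx (by fun_prop)
  rw [← h3, haff, gaussian_shift_density _ _ hv,
    lintegral_withDensity_eq_lintegral_mul _ (by fun_prop) hfx]
  refine lintegral_congr fun y => ?_
  simp only [Pi.mul_apply, NNReal.coe_mk, mul_pow]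


/-- Gaussian sensor model `Y = cX + σZ`: the Bayes-formula representation of `E[X | Y]`. -/
theorem gaussian_sensor_bayes_formula
    {Ω : Type*} {mΩ : MeasurableSpace Ω} (P : Measure Ω) [IsProbabilityMeasure P]
    (X Z : Ω → ℝ) (hXmeas : Measurable X) (hZmeas : Measurable Z)
    (hindep : IndepFun X Z P)
    (μx : ℝ) (v : ℝ≥0) (hv : 0 < v)
    (hXlaw : P.map X = gaussianReal μx v)
    (hZlaw : P.map Z = gaussianReal 0 1)
    (c σ : ℝ) (hc : c ≠ 0) (hσ : 0 < σ)
    (Y : Ω → ℝ) (hY : Y = fun ω => c * X ω + σ * Z ω) :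
    (∀ y : ℝ, Integrable
      (fun ω => Real.exp (-(c ^ 2 * X ω ^ 2) / (2 * σ ^ 2) + c * X ω * y / σ ^ 2)) P) ∧
    (∀ y : ℝ, Integrable
      (fun ω => X ω * Real.exp (-(c ^ 2 * X ω ^ 2) / (2 * σ ^ 2) + c * X ω * y / σ ^ 2)) P) ∧
    (∀ y : ℝ,
      0 < ∫ ω, Real.exp (-(c ^ 2 * X ω ^ 2) / (2 * σ ^ 2) + c * X ω * y / σ ^ 2) ∂P) ∧
    (P[X | MeasurableSpace.comap Y inferInstance] =ᵐ[P] fun ω =>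
      (∫ ω', X ω' * Real.exp (-(c ^ 2 * X ω' ^ 2) / (2 * σ ^ 2) + c * X ω' * Y ω / σ ^ 2) ∂P)
      / (∫ ω', Real.exp (-(c ^ 2 * X ω' ^ 2) / (2 * σ ^ 2) + c * X ω' * Y ω / σ ^ 2) ∂P)) := by

  have hXi : Integrable X P := by
    have h : Integrable id (P.map X) := by
      rw [hXlaw]
      exact (memLp_id_gaussianReal (μ := μx) (v := v) 1).integrable (by simp)
    exact (integrable_map_measure aestronglyMeasurable_id hXmeas.aemeasurable).1 h
  have hbound : ∀ y x : ℝ, ‖Real.exp (-(c ^ 2 * x ^ 2) / (2 * σ ^ 2) + c * x * y / σ ^ 2)‖ ≤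
      Real.exp (y ^ 2 / (2 * σ ^ 2)) := by
    intro y x
    rw [Real.norm_of_nonneg (Real.exp_pos _).le, Real.exp_le_exp]
    have h : y ^ 2 / (2 * σ ^ 2) - (-(c ^ 2 * x ^ 2) / (2 * σ ^ 2) + c * x * y / σ ^ 2) =
        (c * x - y) ^ 2 / (2 * σ ^ 2) := by
      field_simp
      ring
    have h' : 0 ≤ (c * x - y) ^ 2 / (2 * σ ^ 2) := by positivity
    linarith
  have h1 : ∀ y : ℝ, Integrable
      (fun ω => Real.exp (-(c ^ 2 * X ω ^ 2) / (2 * σ ^ 2) + c * X ω * y / σ ^ 2)) P := fun y =>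
    Integrable.of_bound (by fun_prop) _ (.of_forall fun ω => hbound y (X ω))
  have h3 : ∀ y : ℝ,
      0 < ∫ ω, Real.exp (-(c ^ 2 * X ω ^ 2) / (2 * σ ^ 2) + c * X ω * y / σ ^ 2) ∂P :=
    fun y => integral_exp_pos (h1 y)
  refine ⟨h1, fun y => ?_, h3, ?_⟩
  · exact hXi.mul_bdd (c := Real.exp (y ^ 2 / (2 * σ ^ 2))) (by fun_prop)
      (.of_forall fun ω => hbound y (X ω))
  have hYm : Measurable Y := by rw [hY]; fun_prop
  have : IsProbabilityMeasure (P.map X) := Measure.isProbabilityMeasure_map hXmeas.aemeasurable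
  have hD : ∀ y : ℝ,
      ∫ x, Real.exp (-(c ^ 2 * x ^ 2) / (2 * σ ^ 2) + c * x * y / σ ^ 2) ∂(P.map X) =
      ∫ ω, Real.exp (-(c ^ 2 * X ω ^ 2) / (2 * σ ^ 2) + c * X ω * y / σ ^ 2) ∂P := fun y =>
    integral_map hXmeas.aemeasurable (by fun_prop)
  have hN : ∀ y : ℝ,
      ∫ x, x * Real.exp (-(c ^ 2 * x ^ 2) / (2 * σ ^ 2) + c * x * y / σ ^ 2) ∂(P.map X) =
      ∫ ω, X ω * Real.exp (-(c ^ 2 * X ω ^ 2) / (2 * σ ^ 2) + c * X ω * y / σ ^ 2) ∂P := fun y =>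
    integral_map hXmeas.aemeasurable (by fun_prop)
  have hlaw := gaussian_joint_law P X Z hXmeas hZmeas hindep hZlaw c σ hσ
  have hmain := abstract_bayes P X Y hXmeas hYm hXi (P.map X)
    (gaussianReal 0 (NNReal.mk (σ ^ 2) (sq_nonneg σ)))
    (fun p => Real.exp (-(c ^ 2 * p.1 ^ 2) / (2 * σ ^ 2) + c * p.1 * p.2 / σ ^ 2))
    (by fun_prop) (fun p => (Real.exp_pos _).le) (by rw [hY]; exact hlaw)
    (fun y => Integrable.of_bound (by fun_prop) _ (.of_forall fun x => hbound y x))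
    (fun y => by simpa only [hD] using h3 y)
  simpa only [hD, hN] using hmain
end

section
/- Under the stated Gaussian sensor model, set W := exp(−c²X²/(2σ²)). Then the conditional variance of X given Y is almost surely constant and equals E[X² | Y] − (E[X | Y])² = E[X²W]/E[W] − (E[XW]/E[W])² almost surely. -/
open MeasureTheory ProbabilityTheory
open scoped NNReal

lemma aux_pdf (μ s : ℝ) (v v' : ℝ≥0) (hv : 0 < v) (hv' : 0 < v')
    (h : (v' : ℝ) * (1 + 2 * s * v) = v) :
    ∃ K : ℝ, 0 < K ∧ ∀ x : ℝ, gaussianPDFReal μ v x * Real.exp (-(s * x ^ 2))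
      = K * gaussianPDFReal (μ * v' / v) v' x := by
  have hvr : (0 : ℝ) < v := by exact_mod_cast hv
  have hvr' : (0 : ℝ) < v' := by exact_mod_cast hv'
  have hp := Real.pi_pos
  refine ⟨(Real.sqrt (2 * Real.pi * v))⁻¹ * Real.sqrt (2 * Real.pi * v')
    * Real.exp (-(μ ^ 2) / (2 * v) + (μ * v' / v) ^ 2 / (2 * v')), by positivity, fun x => ?_⟩
  have hs : s = (v - v') / (2 * v * v') := by
    field_simp; linarith
  have h2 : Real.sqrt (2 * Real.pi * v') ≠ 0 := by positivity
  rw [gaussianPDFReal, gaussianPDFReal]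
  have e : Real.exp (-(x - μ) ^ 2 / (2 * v)) * Real.exp (-(s * x ^ 2))
      = Real.exp (-(μ ^ 2) / (2 * v) + (μ * v' / v) ^ 2 / (2 * v'))
        * Real.exp (-(x - μ * v' / v) ^ 2 / (2 * v')) := by
    rw [← Real.exp_add, ← Real.exp_add]
    congr 1
    rw [hs]
    field_simp
    ring
  rw [mul_assoc, e]
  field_simp

lemma aux_rhs {Ω : Type*} {mΩ : MeasurableSpace Ω} (P : Measure Ω) [IsProbabilityMeasure P]
    (X : Ω → ℝ) (hXmeas : Measurable X) (μ s : ℝ) (v v' : ℝ≥0) (hv : 0 < v) (hv' : 0 < v')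
    (h : (v' : ℝ) * (1 + 2 * s * v) = v) (hXlaw : P.map X = gaussianReal μ v) :
    (∫ ω, X ω ^ 2 * Real.exp (-(s * X ω ^ 2)) ∂P) / (∫ ω, Real.exp (-(s * X ω ^ 2)) ∂P)
          - ((∫ ω, X ω * Real.exp (-(s * X ω ^ 2)) ∂P)
            / (∫ ω, Real.exp (-(s * X ω ^ 2)) ∂P)) ^ 2 = v' := by
  obtain ⟨K, hK, hK'⟩ := aux_pdf μ s v v' hv hv' h
  have key : ∀ f : ℝ → ℝ, Measurable f → ∫ ω, f (X ω) * Real.exp (-(s * X ω ^ 2)) ∂P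
      = K * ∫ x, f x ∂(gaussianReal (μ * v' / v) v') := by
    intro f hf
    have h1 : ∫ ω, f (X ω) * Real.exp (-(s * X ω ^ 2)) ∂P
        = ∫ x, f x * Real.exp (-(s * x ^ 2)) ∂(P.map X) := by
      rw [integral_map hXmeas.aemeasurable]
      exact (by fun_prop : Measurable _).aestronglyMeasurable
    rw [h1, hXlaw, integral_gaussianReal_eq_integral_smul hv.ne',
      integral_gaussianReal_eq_integral_smul hv'.ne', ← integral_const_mul]
    congr 1
    ext x
    simp only [smul_eq_mul]
    linear_combination f x * hK' x
  have k0 := key (fun _ => 1) measurable_const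
  have k1 := key (fun x => x) measurable_id
  have k2 := key (fun x => x ^ 2) (by fun_prop)
  simp only [one_mul] at k0
  rw [k0, k1, k2]
  have hvar := variance_eq_sub (memLp_id_gaussianReal (μ := μ * v' / v) (v := v') 2)
  rw [variance_id_gaussianReal] at hvar
  refine Eq.trans ?_ hvar.symm
  rw [integral_const, probReal_univ, one_smul, mul_one, mul_div_cancel_left₀ _ hK.ne',
    mul_div_cancel_left₀ _ hK.ne']
  rfl

/-- Gaussian sensor model: the conditional variance of `X` given `Y` is a.s. constant and
equals `E[X²W]/E[W] − (E[XW]/E[W])²` with `W = exp(−c²X²/(2σ²))`. -/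
theorem gaussian_sensor_conditional_variance
    {Ω : Type*} {mΩ : MeasurableSpace Ω} (P : Measure Ω) [IsProbabilityMeasure P]
    (X Z : Ω → ℝ) (hXmeas : Measurable X) (hZmeas : Measurable Z)
    (hindep : IndepFun X Z P)
    (μx : ℝ) (v : ℝ≥0) (hv : 0 < v)
    (hXlaw : P.map X = gaussianReal μx v)
    (hZlaw : P.map Z = gaussianReal 0 1)
    (c σ : ℝ) (hc : c ≠ 0) (hσ : 0 < σ)
    (Y : Ω → ℝ) (hY : Y = fun ω => c * X ω + σ * Z ω)
    (W : Ω → ℝ) (hW : W = fun ω => Real.exp (-(c ^ 2 * X ω ^ 2) / (2 * σ ^ 2))) :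
    (fun ω => (P[fun ω' => X ω' ^ 2 | MeasurableSpace.comap Y inferInstance]) ω
        - ((P[X | MeasurableSpace.comap Y inferInstance]) ω) ^ 2)
      =ᵐ[P] fun _ =>
        (∫ ω, X ω ^ 2 * W ω ∂P) / (∫ ω, W ω ∂P)
          - ((∫ ω, X ω * W ω ∂P) / (∫ ω, W ω ∂P)) ^ 2 := by
  have hvr : (0 : ℝ) < v := by exact_mod_cast hv
  have hD : (0 : ℝ) < c ^ 2 * v + σ ^ 2 := by positivity
  set v' : ℝ≥0 := ⟨v * σ ^ 2 / (c ^ 2 * v + σ ^ 2), by positivity⟩ with hv'def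
  have hv'r : (v' : ℝ) = v * σ ^ 2 / (c ^ 2 * v + σ ^ 2) := rfl
  have hv' : 0 < v' := by
    rw [← NNReal.coe_pos, hv'r]; positivity
  have hW' : W = fun ω => Real.exp (-(c ^ 2 / (2 * σ ^ 2) * X ω ^ 2)) := by
    rw [hW]; ext ω; congr 1; ring
  have hrhs := aux_rhs P X hXmeas μx (c ^ 2 / (2 * σ ^ 2)) v v' hv hv'
    (by rw [hv'r]; field_simp; ring) hXlaw
  rw [hW']
  simp only [hrhs]
  -- conditional side
  have hYmeas : Measurable Y := by rw [hY]; fun_prop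
  have hm : MeasurableSpace.comap Y inferInstance ≤ mΩ := hYmeas.comap_le
  have gX : HasGaussianLaw X P := ⟨by rw [hXlaw]; infer_instance⟩
  have gZ : HasGaussianLaw Z P := ⟨by rw [hZlaw]; infer_instance⟩
  have gXZ := hindep.hasGaussianLaw gX gZ
  have lX : MemLp X 2 P := gX.memLp_two
  have lZ : MemLp Z 2 P := gZ.memLp_two
  have vX : Var[X; P] = v := by
    have := variance_id_gaussianReal (μ := μx) (v := v)
    rwa [← hXlaw, variance_map aemeasurable_id hXmeas.aemeasurable] at this
  have vZ : Var[Z; P] = 1 := by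
    have := variance_id_gaussianReal (μ := 0) (v := 1)
    rwa [← hZlaw, variance_map aemeasurable_id hZmeas.aemeasurable] at this
  have cXZ : cov[X, Z; P] = 0 := hindep.covariance_eq_zero lX lZ
  have cZX : cov[Z, X; P] = 0 := by rw [covariance_comm]; exact cXZ
  have cXX : cov[X, X; P] = v := by rw [covariance_self hXmeas.aemeasurable, vX]
  have cZZ : cov[Z, Z; P] = 1 := by rw [covariance_self hZmeas.aemeasurable, vZ]
  have cov4 : ∀ a b d e : ℝ, cov[a • X + b • Z, d • X + e • Z; P] = a * d * v + b * e := by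
    intro a b d e
    rw [covariance_add_left (lX.const_smul a) (lZ.const_smul b)
        ((lX.const_smul d).add (lZ.const_smul e)),
      covariance_add_right (lX.const_smul a) (lX.const_smul d) (lZ.const_smul e),
      covariance_add_right (lZ.const_smul b) (lX.const_smul d) (lZ.const_smul e)]
    simp only [covariance_smul_left, covariance_smul_right, cXX, cXZ, cZX, cZZ]
    ring
  set a : ℝ := c * v / (c ^ 2 * v + σ ^ 2) with ha
  set R : Ω → ℝ := (1 - a * c) • X + (-(a * σ)) • Z with hR
  have hY' : Y = c • X + σ • Z := by rw [hY]; rfl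
  have hXR : X = a • Y + R := by
    ext ω; simp [hR, hY']; ring
  have cRY : cov[R, Y; P] = 0 := by
    rw [hY', hR, cov4, ha]; field_simp; ring
  have hRmeas : Measurable R := by rw [hR]; fun_prop
  have vR : Var[R; P] = v' := by
    rw [← covariance_self hRmeas.aemeasurable, hR, cov4, hv'r, ha]; field_simp; ring
  have lR : MemLp R 2 P := (lX.const_smul _).add (lZ.const_smul _)
  have lY : MemLp Y 2 P := by rw [hY']; exact (lX.const_smul _).add (lZ.const_smul _)
  have gRY : HasGaussianLaw (fun ω => (R ω, Y ω)) P := by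
    have := gXZ.map_fun
      (((1 - a * c) • ContinuousLinearMap.fst ℝ ℝ ℝ + (-(a * σ)) • ContinuousLinearMap.snd ℝ ℝ ℝ).prod
        (c • ContinuousLinearMap.fst ℝ ℝ ℝ + σ • ContinuousLinearMap.snd ℝ ℝ ℝ))
    rw [hY', hR]
    exact this
  have iRY : IndepFun R Y P := gRY.indepFun_of_covariance_eq_zero cRY
  have iR : Integrable R P := lR.integrable (by norm_num)
  have iY : Integrable Y P := lY.integrable (by norm_num)
  have ce : ∀ g : ℝ → ℝ, Measurable g →
      P[g ∘ R | MeasurableSpace.comap Y inferInstance] =ᵐ[P] fun _ => ∫ ω, g (R ω) ∂P := by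
    intro g hg
    refine condExp_indep_eq hRmeas.comap_le hm ?_ iRY
    exact (hg.comp (comap_measurable R)).stronglyMeasurable
  have c1 : P[X | MeasurableSpace.comap Y inferInstance] =ᵐ[P] fun ω => a * Y ω + ∫ ω, R ω ∂P := by
    have h1 := condExp_add (iY.smul a) iR (MeasurableSpace.comap Y inferInstance)
    rw [← hXR] at h1
    have h2 : P[a • Y | MeasurableSpace.comap Y inferInstance] = a • Y :=
      condExp_of_stronglyMeasurable hm
        ((comap_measurable Y).const_smul a).stronglyMeasurable (iY.smul a)
    have h3 := ce id measurable_id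
    filter_upwards [h1, h3] with ω e1 e3
    rw [e1, Pi.add_apply, h2]
    simp only [Function.id_comp, id] at e3
    rw [e3]; rfl
  have hcv := condVar_ae_eq_condExp_sq_sub_sq_condExp hm lX
  have c2 : Var[X; P | MeasurableSpace.comap Y inferInstance] =ᵐ[P] fun _ => (v' : ℝ) := by
    have h4 := ce (fun x => (x - ∫ ω, R ω ∂P) ^ 2) (by fun_prop)
    rw [← variance_eq_integral hRmeas.aemeasurable, vR] at h4
    refine Filter.EventuallyEq.trans (condExp_congr_ae ?_) h4
    filter_upwards [c1] with ω e
    simp only [Pi.pow_apply, Pi.sub_apply, Function.comp, e]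
    congr 1
    conv_lhs => rw [hXR]
    simp
  filter_upwards [hcv, c2] with ω e1 e2
  rw [← e2, e1]
  rfl
end
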